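/- For all complex numbers z₁, z₂ with z₁ ∉ {0,1}, z₂ ∉ {0,1} and z₁ ≠ z₂, one has the five-term identity 2·f(z₁) − 2·f(z₂) + 2·f(z₂/z₁) − 2·f((1−z₂)/(1−z₁)) + 2·f((1−z₂⁻¹)/(1−z₁⁻¹)) = 0 in ⋀²(ℂˣ/μ_ℂ), where f(z) denotes the wedge [z] ∧ [1−z] of the classes of z and 1−z. (This expresses that z ↦ 2(z ∧ (1−z)) defines a homomorphism from the pre-Bloch group 𝒫(ℂ) to ⋀²(ℂˣ/μ_ℂ).) -/

import Mathlib

noncomputable section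

/-- The group `ℂˣ/μ_ℂ`: the quotient of the multiplicative group of nonzero complex
numbers by its torsion subgroup `μ_ℂ` (the group of roots of unity), viewed additively
as a `ℤ`-module. -/
abbrev CxModMu : Type := Additive (ℂˣ ⧸ CommGroup.torsion ℂˣ)

/-- The class in `ℂˣ/μ_ℂ` of a nonzero complex number (with junk value `0` for `z = 0`). -/
def cls (z : ℂ) : CxModMu :=
  if h : z = 0 then 0 else Additive.ofMul (QuotientGroup.mk (Units.mk0 z h))

/-- `f(z) = [z] ∧ [1 - z]`, the wedge of the classes of `z` and `1 - z` in
`⋀²(ℂˣ/μ_ℂ)`, the second exterior power over `ℤ` of `ℂˣ/μ_ℂ`. -/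
def wedgeCls (z : ℂ) : (⋀[ℤ]^2 CxModMu : Submodule ℤ (ExteriorAlgebra ℤ CxModMu)) :=
  ⟨ExteriorAlgebra.ιMulti ℤ 2 ![cls z, cls (1 - z)],
    ExteriorAlgebra.ιMulti_range ℤ 2 (Set.mem_range_self _)⟩

/-- The class map sends a quotient of nonzero complex numbers to the difference of the classes. -/
theorem cls_div {x y : ℂ} (hx : x ≠ 0) (hy : y ≠ 0) : cls (x / y) = cls x - cls y := by
  rw [cls, cls, cls, dif_neg (div_ne_zero hx hy), dif_neg hx, dif_neg hy, ← ofMul_div,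
    ← QuotientGroup.mk_div]
  congr 2
  ext
  simp

/-- The class map sends a product of nonzero complex numbers to the sum of the classes. -/
theorem cls_mul {x y : ℂ} (hx : x ≠ 0) (hy : y ≠ 0) : cls (x * y) = cls x + cls y := by
  have h := cls_div (mul_ne_zero hx hy) hy
  rw [mul_div_cancel_right₀ x hy] at h
  rw [h, sub_add_cancel]

/-- A complex number and its negative have the same class, as `-1` is a root of unity. -/
theorem cls_neg (x : ℂ) : cls (-x) = cls x := by
  by_cases hx : x = 0
  · rw [hx, neg_zero]
  rw [cls, cls, dif_neg (neg_ne_zero.mpr hx), dif_neg hx]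
  congr 1
  rw [QuotientGroup.eq, CommGroup.mem_torsion, isOfFinOrder_iff_pow_eq_one]
  refine ⟨2, two_pos, ?_⟩
  ext
  simp [mul_pow, hx]

/-- In the exterior algebra, `wedgeCls z` is the product of the classes of `z` and `1 - z`. -/
theorem coe_wedgeCls (z : ℂ) :
    (wedgeCls z : ExteriorAlgebra ℤ CxModMu) =
      ExteriorAlgebra.ι ℤ (cls z) * ExteriorAlgebra.ι ℤ (cls (1 - z)) := by
  simp [wedgeCls, ExteriorAlgebra.ιMulti_apply]

/-- The five-term combination of wedges, in terms of the classes `a, b, c, d, e` of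
`z₁, 1 - z₁, z₂, 1 - z₂, z₁ - z₂`, vanishes in any exterior algebra. -/
theorem ExteriorAlgebra.five_term {R M : Type*} [CommRing R] [AddCommGroup M] [Module R M]
    (a b c d e : M) :
    ι R a * ι R b - ι R c * ι R d + ι R (c - a) * ι R (e - a) - ι R (d - b) * ι R (e - b)
      + ι R (d - b - (c - a)) * ι R (e - (c + b)) = 0 := by
  have swap (x y : M) : ι R x * ι R y = -(ι R y * ι R x) :=
    eq_neg_of_add_eq_zero_left (ι_add_mul_swap x y)
  simp only [map_sub, map_add, mul_sub, sub_mul, mul_add, ι_sq_zero]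
  rw [swap d c, swap c a, swap c b]
  abel

/-- The five-term relation: `z ↦ 2(z ∧ (1-z))` kills the five-term relation defining the
pre-Bloch group `𝒫(ℂ)`, hence defines a homomorphism `𝒫(ℂ) → ⋀²(ℂˣ/μ_ℂ)`. -/
theorem five_term_identity (z₁ z₂ : ℂ) (h₁0 : z₁ ≠ 0) (h₁1 : z₁ ≠ 1)
    (h₂0 : z₂ ≠ 0) (h₂1 : z₂ ≠ 1) (hne : z₁ ≠ z₂) :
    (2 : ℤ) • wedgeCls z₁ - (2 : ℤ) • wedgeCls z₂ + (2 : ℤ) • wedgeCls (z₂ / z₁)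
      - (2 : ℤ) • wedgeCls ((1 - z₂) / (1 - z₁))
      + (2 : ℤ) • wedgeCls ((1 - z₂⁻¹) / (1 - z₁⁻¹)) = 0 := by
  have h₁ : 1 - z₁ ≠ 0 := sub_ne_zero.mpr h₁1.symm
  have h₂ : 1 - z₂ ≠ 0 := sub_ne_zero.mpr h₂1.symm
  have h₁₂ : z₁ - z₂ ≠ 0 := sub_ne_zero.mpr hne
  have e₁ : 1 - z₂ / z₁ = (z₁ - z₂) / z₁ := by field_simp
  have e₂ : 1 - (1 - z₂) / (1 - z₁) = -((z₁ - z₂) / (1 - z₁)) := by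
    field_simp
    ring
  have e₃ : (1 - z₂⁻¹) / (1 - z₁⁻¹) = (1 - z₂) / (1 - z₁) / (z₂ / z₁) := by
    have i₁ : 1 - z₁⁻¹ = -((1 - z₁) / z₁) := by field_simp; ring
    have i₂ : 1 - z₂⁻¹ = -((1 - z₂) / z₂) := by field_simp; ring
    rw [i₁, i₂, neg_div_neg_eq]
    field_simp
  have e₄ : 1 - (1 - z₂) / (1 - z₁) / (z₂ / z₁) = -((z₁ - z₂) / (z₂ * (1 - z₁))) := by
    field_simp
    ring
  rw [← zsmul_sub, ← zsmul_add, ← zsmul_sub, ← zsmul_add]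
  convert zsmul_zero (2 : ℤ)
  ext
  simp only [Submodule.coe_add, Submodule.coe_sub, Submodule.coe_zero, coe_wedgeCls]
  rw [e₃, e₁, e₂, e₄, cls_neg, cls_neg, cls_div (div_ne_zero h₂ h₁) (div_ne_zero h₂0 h₁0),
    cls_div h₂ h₁, cls_div h₂0 h₁0, cls_div h₁₂ h₁0, cls_div h₁₂ h₁,
    cls_div h₁₂ (mul_ne_zero h₂0 h₁), cls_mul h₂0 h₁]
  exact ExteriorAlgebra.five_term _ _ _ _ _

end
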